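/- For all nonnegative integers n and N, the number of partitions λ with distinct parts such that λ_2 + λ_4 + λ_6 + ⋯ = n and |λ| = N equals the number of partitions μ with all parts odd such that |μ| = N and |μ| − ℓ(μ) = 2n. (This is the coefficient-wise form of the identity ∑_{λ∈𝒟} z^{|λ|} q^{λ_2+λ_4+λ_6+⋯} = 1/(z; qz²)_∞.) -/

import Mathlib

/-- A partition: a weakly decreasing sequence of naturals with finite support.
`p.parts i` is the `(i+1)`-st part, i.e. parts are 0-indexed (`λ_1 = p.parts 0`). -/
structure Ptn where
  parts : ℕ → ℕ
  antitone' : ∀ ⦃i j : ℕ⦄, i ≤ j → parts j ≤ parts i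
  finite_support' : (Function.support parts).Finite

namespace Ptn

/-- The size `|λ|` of a partition: the sum of all its parts. -/
noncomputable def size (p : Ptn) : ℕ := ∑ᶠ i, p.parts i

/-- The number of (nonzero) parts `ℓ(λ)`. -/
noncomputable def length (p : Ptn) : ℕ := (Function.support p.parts).ncard

/-- A partition has distinct parts if no nonzero value is repeated. -/
def Distinct (p : Ptn) : Prop := ∀ i : ℕ, p.parts (i + 1) ≠ 0 → p.parts (i + 1) < p.parts i

/-- A partition has odd parts if every part is odd. -/
def OddParts (p : Ptn) : Prop := ∀ i : ℕ, p.parts i ≠ 0 → Odd (p.parts i)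

end Ptn

namespace Ptn

theorem parts_injective : Function.Injective Ptn.parts := by
  rintro ⟨f, _, _⟩ ⟨g, _, _⟩ h
  cases h
  rfl

theorem exists_parts_le (p : Ptn) (j : ℕ) : ∃ i, p.parts i ≤ j := by
  obtain ⟨i, hi⟩ := p.finite_support'.exists_notMem
  refine ⟨i, ?_⟩
  rw [Function.notMem_support.mp hi]
  exact Nat.zero_le j

/-- The number of parts exceeding `j`, found as the first index where the parts drop to `j`. -/
def count (p : Ptn) (j : ℕ) : ℕ := Nat.find (p.exists_parts_le j)

theorem lt_count_iff (p : Ptn) (i j : ℕ) : i < p.count j ↔ j < p.parts i := by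
  rw [count, Nat.lt_find_iff]
  refine ⟨fun h => not_le.mp (h i le_rfl), fun h m hm => ?_⟩
  have := p.antitone' hm
  omega

/-- The conjugate partition. -/
def conj (p : Ptn) : Ptn where
  parts := p.count
  antitone' i j hij := by
    by_contra! h
    rw [lt_count_iff] at h
    have := (p.lt_count_iff (p.count i) i).mpr (hij.trans_lt h)
    omega
  finite_support' := by
    refine (Set.finite_Iio (p.parts 0)).subset fun j hj => ?_
    exact (p.lt_count_iff 0 j).mp (Nat.pos_of_ne_zero hj)

theorem lt_conj_iff (p : Ptn) (i j : ℕ) : i < p.conj.parts j ↔ j < p.parts i :=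
  p.lt_count_iff i j

theorem conj_conj (p : Ptn) : p.conj.conj = p := by
  refine parts_injective (funext fun i => eq_of_forall_lt_iff fun j => ?_)
  rw [lt_conj_iff, lt_conj_iff]

theorem conj_injective : Function.Injective conj :=
  Function.LeftInverse.injective conj_conj

theorem length_eq_conj_parts_zero (p : Ptn) : p.length = p.conj.parts 0 := by
  have : Function.support p.parts = Finset.range (p.conj.parts 0) := by
    ext i
    simp [lt_conj_iff, Nat.pos_iff_ne_zero]
  rw [length, this, Set.ncard_coe_finset, Finset.card_range]

theorem length_conj (p : Ptn) : p.conj.length = p.parts 0 := by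
  rw [length_eq_conj_parts_zero, conj_conj]

theorem size_eq_sum_range (p : Ptn) : p.size = ∑ i ∈ Finset.range p.length, p.parts i := by
  refine finsum_eq_sum_of_support_subset _ fun i hi => ?_
  rw [length_eq_conj_parts_zero]
  simpa [lt_conj_iff, Nat.pos_iff_ne_zero] using hi

theorem parts_eq_sum_range (p : Ptn) (i : ℕ) :
    p.parts i = ∑ j ∈ Finset.range (p.parts 0), if j < p.parts i then 1 else 0 := by
  have h : (Finset.range (p.parts 0)).filter (· < p.parts i) = Finset.range (p.parts i) := by
    ext j
    have := p.antitone' (Nat.zero_le i)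
    simp only [Finset.mem_filter, Finset.mem_range]
    omega
  rw [← Finset.card_filter, h, Finset.card_range]

theorem size_conj (p : Ptn) : p.conj.size = p.size := by
  rw [size_eq_sum_range, size_eq_sum_range, length_conj,
    Finset.sum_congr rfl fun i _ => p.conj.parts_eq_sum_range i,
    Finset.sum_congr rfl fun i _ => p.parts_eq_sum_range i, Finset.sum_comm,
    length_eq_conj_parts_zero]
  simp only [lt_conj_iff]

/-- The empty partition. -/
def empty : Ptn where
  parts _ := 0
  antitone' _ _ _ := le_rfl
  finite_support' := by simp

theorem eq_empty_of_parts_zero {p : Ptn} (h : p.parts 0 = 0) : p = empty := by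
  refine parts_injective (funext fun i => ?_)
  have := p.antitone' (Nat.zero_le i)
  simp only [empty]
  omega

/-- Remove the largest part. -/
def tail (p : Ptn) : Ptn where
  parts i := p.parts (i + 1)
  antitone' _ _ h := p.antitone' (Nat.succ_le_succ h)
  finite_support' := p.finite_support'.preimage (add_left_injective 1).injOn

/-- Prepend a new largest part. -/
def cons (r : ℕ) (p : Ptn) (h : p.parts 0 ≤ r) : Ptn where
  parts i := i.casesOn r p.parts
  antitone' i j hij := by
    rcases i with _ | i <;> rcases j with _ | j
    · exact le_rfl
    · exact (p.antitone' (Nat.zero_le j)).trans h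
    · omega
    · exact p.antitone' (by omega)
  finite_support' := by
    obtain ⟨m, hm⟩ := p.exists_parts_le 0
    refine (Set.finite_Iio (m + 1)).subset fun i hi => ?_
    rcases i with _ | i
    · simp
    · by_contra hlt
      have : m ≤ i := by simpa using hlt
      have := p.antitone' this
      exact hi (by change p.parts i = 0; omega)

theorem tail_cons (r : ℕ) (p : Ptn) (h : p.parts 0 ≤ r) : (cons r p h).tail = p := rfl

theorem ext_of_tail {p q : Ptn} (h₀ : p.parts 0 = q.parts 0) (h : p.tail = q.tail) : p = q := by
  refine parts_injective (funext fun i => ?_)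
  rcases i with _ | i
  · exact h₀
  · exact congrFun (congrArg parts h) i

theorem finsum_nat_eq_zero_add {f : ℕ → ℕ} (hf : (Function.support f).Finite) :
    ∑ᶠ i, f i = f 0 + ∑ᶠ i, f (i + 1) := by
  obtain ⟨m, hm⟩ := hf.bddAbove
  have h₁ : Function.support f ⊆ Finset.range (m + 1) := fun i hi => by
    have := hm hi
    simp
    omega
  have h₂ : Function.support (fun i => f (i + 1)) ⊆ Finset.range m := fun i hi => by
    have := hm (show i + 1 ∈ Function.support f from hi)
    simp
    omega
  rw [finsum_eq_sum_of_support_subset _ h₁, finsum_eq_sum_of_support_subset _ h₂,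
    Finset.sum_range_succ', add_comm]

theorem size_eq_add_tail (p : Ptn) : p.size = p.parts 0 + p.tail.size :=
  finsum_nat_eq_zero_add p.finite_support'

/-- The sum `λ₁ + λ₃ + λ₅ + ⋯`. -/
noncomputable def oddIndexSum (p : Ptn) : ℕ := ∑ᶠ k : ℕ, p.parts (2 * k)

/-- The sum `λ₂ + λ₄ + λ₆ + ⋯`. -/
noncomputable def evenIndexSum (p : Ptn) : ℕ := ∑ᶠ k : ℕ, p.parts (2 * k + 1)

theorem evenIndexSum_eq_tail (p : Ptn) : p.evenIndexSum = p.tail.oddIndexSum := rfl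

theorem oddIndexSum_eq_add_tail (p : Ptn) : p.oddIndexSum = p.parts 0 + p.tail.evenIndexSum := by
  refine finsum_nat_eq_zero_add (f := fun k => p.parts (2 * k)) ?_
  exact p.finite_support'.preimage fun a _ b _ h => by simpa using h

theorem size_empty : empty.size = 0 := by simp [size, empty]

theorem length_empty : empty.length = 0 := by simp [length, empty]

theorem oddIndexSum_empty : empty.oddIndexSum = 0 := by simp [oddIndexSum, empty]

theorem evenIndexSum_empty : empty.evenIndexSum = 0 := by simp [evenIndexSum, empty]

theorem length_ne_zero {p : Ptn} (h : p ≠ empty) : p.length ≠ 0 := by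
  rw [length_eq_conj_parts_zero, ← Nat.pos_iff_ne_zero, lt_conj_iff, Nat.pos_iff_ne_zero]
  exact fun h₀ => h (eq_empty_of_parts_zero h₀)

theorem size_tail_lt {p : Ptn} (h : p ≠ empty) : p.tail.size < p.size := by
  have := p.size_eq_add_tail
  have : p.parts 0 ≠ 0 := fun h₀ => h (eq_empty_of_parts_zero h₀)
  omega

theorem size_tail_conj_lt {p : Ptn} (h : p ≠ empty) : p.conj.tail.size < p.size := by
  have h₁ := p.conj.size_eq_add_tail
  have h₂ := length_ne_zero h
  rw [size_conj, ← length_eq_conj_parts_zero] at h₁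
  omega

theorem length_eq_length_tail_add_one {p : Ptn} (h : p ≠ empty) :
    p.length = p.tail.length + 1 := by
  have h₀ := length_ne_zero h
  rw [length_eq_conj_parts_zero] at h₀ ⊢
  rw [length_eq_conj_parts_zero]
  obtain ⟨m, hm⟩ := Nat.exists_eq_succ_of_ne_zero h₀
  rw [hm]
  congr 1
  refine eq_of_forall_lt_iff fun i => ?_
  rw [lt_conj_iff]
  change _ ↔ 0 < p.parts (i + 1)
  rw [← lt_conj_iff, hm, Nat.succ_eq_add_one, Nat.add_lt_add_iff_right]

theorem conj_ne_empty {p : Ptn} (h : p ≠ empty) : p.conj ≠ empty := fun h₀ => by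
  have := congrFun (congrArg parts h₀) 0
  rw [← length_eq_conj_parts_zero] at this
  exact length_ne_zero h this

/-- The largest hook length of a partition (zero for the empty one). -/
noncomputable def hook (p : Ptn) : ℕ := p.length + p.conj.tail.length

theorem hook_add_one {p : Ptn} (h : p ≠ empty) : p.hook + 1 = p.length + p.parts 0 := by
  have := length_eq_length_tail_add_one (conj_ne_empty h)
  rw [length_conj] at this
  rw [hook]
  omega

theorem hook_empty : empty.hook = 0 := by
  have h : empty.conj = empty := by
    refine eq_empty_of_parts_zero ?_
    rw [← length_eq_conj_parts_zero, length_empty]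
  rw [hook, h, length_empty, zero_add]
  exact length_empty

theorem parts_zero_add_length_le {p : Ptn} : p.parts 0 + p.length ≤ p.hook + 1 := by
  by_cases h : p = empty
  · subst h
    rw [length_empty]
    exact Nat.zero_le _
  · rw [hook_add_one h, add_comm]

theorem hook_tail_conj_lt {p : Ptn} (h : p ≠ empty) : p.conj.tail.hook < p.hook := by
  have hp := length_ne_zero h
  by_cases ht : p.conj.tail = empty
  · rw [ht, hook_empty, hook]
    omega
  · have h₁ := hook_add_one ht
    have h₂ : p.conj.tail.parts 0 ≤ p.length := by
      rw [length_eq_conj_parts_zero]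
      exact p.conj.antitone' (Nat.zero_le 1)
    rw [hook.eq_def p]
    omega

open Classical in
/-- The sequence of largest hook lengths obtained by alternately deleting the first column
and the first row, together with the fact that its leading entry is the first hook length. -/
noncomputable def hooksAux (p : Ptn) : {q : Ptn // q.parts 0 = p.hook} :=
  if h : p = empty then ⟨empty, by rw [h, hook_empty]; rfl⟩
  else
    have := size_tail_conj_lt h
    ⟨cons p.hook (hooksAux p.conj.tail).1
      ((hooksAux p.conj.tail).2.trans_le (hook_tail_conj_lt h).le), rfl⟩
termination_by p.size

/-- The sequence of largest hook lengths obtained by alternately deleting the first column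
and the first row. -/
noncomputable def hooks (p : Ptn) : Ptn := (hooksAux p).1

theorem hooks_parts_zero (p : Ptn) : p.hooks.parts 0 = p.hook := (hooksAux p).2

theorem hooks_empty : empty.hooks = empty := by
  rw [hooks, hooksAux, dif_pos rfl]

theorem tail_hooks {p : Ptn} (h : p ≠ empty) : p.hooks.tail = p.conj.tail.hooks := by
  rw [hooks, hooksAux, dif_neg h]
  rfl

theorem distinct_iff_tail (p : Ptn) :
    p.Distinct ↔ (p.parts 1 ≠ 0 → p.parts 1 < p.parts 0) ∧ p.tail.Distinct :=
  ⟨fun h => ⟨h 0, fun i => h (i + 1)⟩, fun h i => by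
    rcases i with _ | i
    · exact h.1
    · exact h.2 i⟩

theorem hooks_distinct (p : Ptn) : p.hooks.Distinct := by
  by_cases h : p = empty
  · rw [h, hooks_empty]
    exact fun i hi => absurd rfl hi
  · have := size_tail_conj_lt h
    rw [distinct_iff_tail, tail_hooks h]
    refine ⟨fun _ => ?_, hooks_distinct _⟩
    change p.hooks.tail.parts 0 < _
    rw [tail_hooks h, hooks_parts_zero, hooks_parts_zero]
    exact hook_tail_conj_lt h
termination_by p.size

theorem index_sums_hooks (p : Ptn) :
    p.hooks.oddIndexSum = p.size ∧ p.hooks.evenIndexSum + p.length = p.size := by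
  by_cases h : p = empty
  · rw [h, hooks_empty, oddIndexSum_empty, evenIndexSum_empty, size_empty, length_empty]
    exact ⟨rfl, rfl⟩
  · have := size_tail_conj_lt h
    obtain ⟨h₁, h₂⟩ := index_sums_hooks p.conj.tail
    have h₃ := p.conj.size_eq_add_tail
    rw [size_conj, ← length_eq_conj_parts_zero] at h₃
    rw [oddIndexSum_eq_add_tail, evenIndexSum_eq_tail p.hooks, tail_hooks h, hooks_parts_zero, hook]
    omega
termination_by p.size

theorem hooks_eq_empty_iff {p : Ptn} : p.hooks = empty ↔ p = empty := by
  refine ⟨fun h => by_contra fun hp => ?_, fun h => h ▸ hooks_empty⟩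
  have h₁ := p.hooks_parts_zero
  have h₂ := length_ne_zero hp
  rw [h, hook] at h₁
  change 0 = _ at h₁
  omega

theorem eq_of_hooks_eq (p q : Ptn) (h : p.hooks = q.hooks) : p = q := by
  by_cases hp : p = empty
  · rw [hp, hooks_empty] at h
    rw [hp, hooks_eq_empty_iff.mp h.symm]
  · have hq : q ≠ empty := fun hq => hp (by
      rw [hq, hooks_empty] at h
      exact hooks_eq_empty_iff.mp h)
    have := size_tail_conj_lt hp
    have ht : p.conj.tail = q.conj.tail := eq_of_hooks_eq _ _ (by
      rw [← tail_hooks hp, ← tail_hooks hq, h])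
    have hh : p.hook = q.hook := by
      rw [← hooks_parts_zero, ← hooks_parts_zero, h]
    refine conj_injective (ext_of_tail ?_ ht)
    rw [hook, hook, ht] at hh
    rw [← length_eq_conj_parts_zero, ← length_eq_conj_parts_zero]
    omega
termination_by p.size

theorem hooks_injective : Function.Injective hooks := eq_of_hooks_eq

theorem exists_hooks_eq (q : Ptn) (hq : q.Distinct) : ∃ p : Ptn, p.hooks = q := by
  by_cases h : q = empty
  · exact ⟨empty, h ▸ hooks_empty⟩
  · have := size_tail_lt h
    obtain ⟨h₁, h₂⟩ := q.distinct_iff_tail.mp hq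
    obtain ⟨s, hs⟩ := exists_hooks_eq q.tail h₂
    have hh : q.parts 1 = s.hook := by
      rw [← hooks_parts_zero, hs]
      rfl
    have h₀ : q.parts 0 ≠ 0 := fun h₀ => h (eq_empty_of_parts_zero h₀)
    have hle := s.parts_zero_add_length_le
    have hlen : s.parts 0 + s.length ≤ q.parts 0 := by omega
    have hpos : s.length < q.parts 0 := by
      by_cases hse : s = empty
      · rw [hse, length_empty]
        omega
      · have : s.parts 0 ≠ 0 := fun h₀ => hse (eq_empty_of_parts_zero h₀)
        omega
    let c := cons (q.parts 0 - s.length) s (by omega)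
    have hc : c.conj.length = q.parts 0 - s.length := length_conj c
    have hne : c.conj ≠ empty := fun he => by
      rw [he, length_empty] at hc
      omega
    have ht : c.conj.conj.tail = s := by rw [conj_conj, tail_cons]
    refine ⟨c.conj, ext_of_tail ?_ ?_⟩
    · rw [hooks_parts_zero, hook, ht, hc]
      omega
    · rw [tail_hooks hne, ht, hs]
termination_by q.size

theorem size_eq_oddIndexSum_add_evenIndexSum (p : Ptn) :
    p.size = p.oddIndexSum + p.evenIndexSum := by
  by_cases h : p = empty
  · rw [h, size_empty, oddIndexSum_empty, evenIndexSum_empty]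
  · have := size_tail_lt h
    have ih := size_eq_oddIndexSum_add_evenIndexSum p.tail
    rw [size_eq_add_tail, ih, oddIndexSum_eq_add_tail p, evenIndexSum_eq_tail p]
    omega
termination_by p.size

/-- Replace every part `x` by the odd part `2 * x - 1`. -/
def toOdd (p : Ptn) : Ptn where
  parts i := 2 * p.parts i - 1
  antitone' i j h := by
    have := p.antitone' h
    omega
  finite_support' := p.finite_support'.subset fun i hi h => hi (by simp [h])

theorem toOdd_injective : Function.Injective toOdd := fun p q h => by
  refine parts_injective (funext fun i => ?_)
  have : 2 * p.parts i - 1 = 2 * q.parts i - 1 := congrFun (congrArg parts h) i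
  omega

theorem toOdd_oddParts (p : Ptn) : p.toOdd.OddParts := fun i hi => by
  change 2 * p.parts i - 1 ≠ 0 at hi
  change Odd (2 * p.parts i - 1)
  exact ⟨p.parts i - 1, by omega⟩

theorem exists_toOdd_eq (q : Ptn) (hq : q.OddParts) : ∃ p : Ptn, p.toOdd = q := by
  refine ⟨⟨fun i => (q.parts i + 1) / 2, fun i j h => ?_, ?_⟩, ?_⟩
  · have := q.antitone' h
    omega
  · exact q.finite_support'.subset fun i hi h => hi (by simp [h])
  · refine parts_injective (funext fun i => ?_)
    change 2 * ((q.parts i + 1) / 2) - 1 = q.parts i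
    by_cases h : q.parts i = 0
    · rw [h]
    · obtain ⟨k, hk⟩ := hq i h
      omega

theorem length_toOdd (p : Ptn) : p.toOdd.length = p.length := by
  rw [length, length]
  congr 1
  ext i
  change 2 * p.parts i - 1 ≠ 0 ↔ p.parts i ≠ 0
  omega

theorem size_toOdd_add_length (p : Ptn) : p.toOdd.size + p.length = 2 * p.size := by
  rw [size_eq_sum_range, length_toOdd, size_eq_sum_range, Finset.mul_sum]
  nth_rw 2 [← Finset.card_range p.length]
  rw [Finset.card_eq_sum_ones, ← Finset.sum_add_distrib]
  refine Finset.sum_congr rfl fun i hi => ?_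
  rw [Finset.mem_range, length_eq_conj_parts_zero, lt_conj_iff] at hi
  change 2 * p.parts i - 1 + 1 = _
  omega

end Ptn

/-- Coefficient-wise form of `∑_{λ∈𝒟} z^{|λ|} q^{λ_2+λ_4+⋯} = 1/(z;qz²)_∞`:
distinct-part partitions with even-index Schmidt weight `n` and size `N` are
equinumerous with odd-part partitions `μ` of size `N` with `|μ| - ℓ(μ) = 2n`. -/
theorem mork_product_identity_two (n N : ℕ) :
    {p : Ptn | p.Distinct ∧ (∑ᶠ k : ℕ, p.parts (2 * k + 1)) = n ∧ p.size = N}.ncard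
      = {p : Ptn | p.OddParts ∧ p.size = N ∧ p.size = 2 * n + p.length}.ncard := by
  have hD : {p : Ptn | p.Distinct ∧ (∑ᶠ k : ℕ, p.parts (2 * k + 1)) = n ∧ p.size = N}
      = Ptn.hooks '' {s : Ptn | s.size = n + s.length ∧ s.size + n = N} := by
    ext p
    simp only [Set.mem_ofPred_eq, Set.mem_image]
    constructor
    · rintro ⟨hp, hn, hN⟩
      obtain ⟨s, rfl⟩ := p.exists_hooks_eq hp
      change s.hooks.evenIndexSum = n at hn
      rw [Ptn.size_eq_oddIndexSum_add_evenIndexSum] at hN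
      have := s.index_sums_hooks
      exact ⟨s, by omega, rfl⟩
    · rintro ⟨s, hs, rfl⟩
      have := s.index_sums_hooks
      rw [Ptn.size_eq_oddIndexSum_add_evenIndexSum]
      change _ ∧ s.hooks.evenIndexSum = n ∧ _
      exact ⟨s.hooks_distinct, by omega, by omega⟩
  have hO : {p : Ptn | p.OddParts ∧ p.size = N ∧ p.size = 2 * n + p.length}
      = Ptn.toOdd '' {s : Ptn | s.size = n + s.length ∧ s.size + n = N} := by
    ext p
    simp only [Set.mem_ofPred_eq, Set.mem_image]
    constructor
    · rintro ⟨hp, hN, hn⟩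
      obtain ⟨s, rfl⟩ := p.exists_toOdd_eq hp
      rw [Ptn.length_toOdd] at hn
      have := s.size_toOdd_add_length
      exact ⟨s, by omega, rfl⟩
    · rintro ⟨s, hs, rfl⟩
      have := s.size_toOdd_add_length
      rw [Ptn.length_toOdd]
      exact ⟨s.toOdd_oddParts, by omega, by omega⟩
  rw [hD, hO, Set.ncard_image_of_injective _ Ptn.hooks_injective,
    Set.ncard_image_of_injective _ Ptn.toOdd_injective]
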